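/- Let X be a simplicial complex on [n] and 𝐜 = 𝐚 − 𝐛 with 𝐚 ∈ ℕ^{n+1} of support a ⊆ [n] and 𝐛 ∈ {0,1}^{n+1} the characteristic vector of a nonempty b ⊆ [n], a ∩ b = ∅. A homomorphism φ ∈ Hom(I_X, A_X)_𝐜 lies in the image of the map Der_ℂ(P, P) → Hom_P(I_X, A_X), D ↦ π ∘ D|_{I_X}, if and only if φ = 0, or #b = 1 and the function λ_φ : N_{a−b} → ℂ (determined by φ(x^{f∪b}) = λ_φ(f)·π(x^{𝐟+𝐚})) is constant. In particular, for #b ≥ 2 only the zero homomorphism in Hom(I_X, A_X)_𝐜 comes from a derivation of P. -/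

import Mathlib

open MvPolynomial

/-- A simplicial complex on `[n] = {0,…,n}`. -/
def IsSimplicialComplex {n : ℕ} (S : Set (Finset (Fin (n+1)))) : Prop :=
  ∅ ∈ S ∧ ∀ f ∈ S, ∀ g ⊆ f, g ∈ S

/-- The squarefree monomial `x^p = ∏_{i ∈ p} x_i`. -/
noncomputable def xmon {n : ℕ} (p : Finset (Fin (n+1))) : MvPolynomial (Fin (n+1)) ℂ :=
  ∏ i ∈ p, X i

/-- The monomial `x^e` for an exponent vector `e ∈ ℕ^{n+1}`. -/
noncomputable def emon {n : ℕ} (e : Fin (n+1) → ℕ) : MvPolynomial (Fin (n+1)) ℂ :=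
  monomial (Finsupp.equivFunOnFinite.symm e) 1

/-- The Stanley–Reisner ideal `I_X = (x^p : p ∉ X)`. -/
noncomputable def SRideal {n : ℕ} (S : Set (Finset (Fin (n+1)))) : Ideal (MvPolynomial (Fin (n+1)) ℂ) :=
  Ideal.span {q | ∃ p : Finset (Fin (n+1)), p ∉ S ∧ q = xmon p}

lemma xmon_mem_SRideal {n : ℕ} (S : Set (Finset (Fin (n+1))))
    {p : Finset (Fin (n+1))} (hp : p ∉ S) : xmon p ∈ SRideal S :=
  Ideal.subset_span ⟨p, hp, rfl⟩

/-- The characteristic vector of `p ⊆ [n]`. -/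
def charVec {n : ℕ} (p : Finset (Fin (n+1))) : Fin (n+1) → ℕ :=
  fun i => if i ∈ p then 1 else 0

/-- The degree `𝐜 = 𝐚 − 𝐛 ∈ ℤ^{n+1}` where `𝐛` is the characteristic vector of `b`. -/
def degC {n : ℕ} (A : Fin (n+1) → ℕ) (b : Finset (Fin (n+1))) : Fin (n+1) → ℤ :=
  fun i => (A i : ℤ) - (charVec b i : ℤ)

/-- The shifted exponent `𝐩 + 𝐜` (as a vector of naturals, when nonnegative). -/
def shiftExp {n : ℕ} (p : Finset (Fin (n+1))) (c : Fin (n+1) → ℤ) : Fin (n+1) → ℕ :=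
  fun i => ((charVec p i : ℤ) + c i).toNat

/-- A `P`-module homomorphism `φ : I_X → A_X` is homogeneous of degree `𝐜`:
for every non-face `p`, `φ(x^p)` is a scalar multiple of `π(x^{𝐩+𝐜})` when
`𝐩 + 𝐜 ∈ ℕ^{n+1}`, and `φ(x^p) = 0` otherwise. -/
def IsHomOfDeg {n : ℕ} (S : Set (Finset (Fin (n+1))))
    (φ : SRideal S →ₗ[MvPolynomial (Fin (n+1)) ℂ] (MvPolynomial (Fin (n+1)) ℂ ⧸ SRideal S))
    (c : Fin (n+1) → ℤ) : Prop :=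
  ∀ (p : Finset (Fin (n+1))) (hp : p ∉ S),
    ((∀ i, 0 ≤ (charVec p i : ℤ) + c i) →
      ∃ μ : ℂ, φ ⟨xmon p, xmon_mem_SRideal S hp⟩ =
        Ideal.Quotient.mk (SRideal S) (C μ * emon (shiftExp p c))) ∧
    (¬ (∀ i, 0 ≤ (charVec p i : ℤ) + c i) →
      φ ⟨xmon p, xmon_mem_SRideal S hp⟩ = 0)

/-- The support of a vector `𝐚 ∈ ℕ^{n+1}`. -/
def suppV {n : ℕ} (A : Fin (n+1) → ℕ) : Finset (Fin (n+1)) :=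
  Finset.univ.filter (fun i => A i ≠ 0)

/-- `N_{a−b} = {f ∈ X : a ⊆ f, f ∩ b = ∅, f ∪ b ∉ X}`. -/
def Nab {n : ℕ} (S : Set (Finset (Fin (n+1)))) (a b : Finset (Fin (n+1))) :
    Set (Finset (Fin (n+1))) :=
  {f | f ∈ S ∧ a ⊆ f ∧ f ∩ b = ∅ ∧ f ∪ b ∉ S}

open Classical in
lemma coeff_emon_mul {n : ℕ} (e m : Fin (n+1) → ℕ) (q : MvPolynomial (Fin (n+1)) ℂ) :
    coeff (Finsupp.equivFunOnFinite.symm m) (emon e * q) =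
      if e ≤ m then coeff (Finsupp.equivFunOnFinite.symm (m - e)) q else 0 := by
  have hsub : Finsupp.equivFunOnFinite.symm m - Finsupp.equivFunOnFinite.symm e =
      Finsupp.equivFunOnFinite.symm (m - e) := by
    ext; simp
  have hle : Finsupp.equivFunOnFinite.symm e ≤ Finsupp.equivFunOnFinite.symm m ↔ e ≤ m := by
    rfl
  rw [emon, coeff_monomial_mul', hsub, one_mul]
  simp only [hle]

lemma emon_mul_emon {n : ℕ} (d e : Fin (n+1) → ℕ) : emon d * emon e = emon (d + e) := by
  rw [emon, emon, emon, monomial_mul, one_mul]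
  congr 2
  ext
  simp

lemma xmon_eq_emon {n : ℕ} (p : Finset (Fin (n+1))) : xmon p = emon (charVec p) := by
  have h : Finsupp.equivFunOnFinite.symm (charVec p) = ∑ i ∈ p, Finsupp.single i 1 := by
    ext k
    simp [charVec, Finsupp.finsetSum_apply, Finsupp.single_apply]
  rw [emon, h, monomial_sum_one]
  rfl

lemma charVec_le_iff {n : ℕ} (p : Finset (Fin (n+1))) (m : Fin (n+1) → ℕ) :
    charVec p ≤ m ↔ p ⊆ suppV m := by
  simp only [Pi.le_def, charVec, suppV, Finset.subset_iff, Finset.mem_filter, Finset.mem_univ,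
    true_and]
  refine forall_congr' fun i => ?_
  split_ifs with h <;> simp [h, Nat.one_le_iff_ne_zero]

lemma emon_mem_SRideal {n : ℕ} {S : Set (Finset (Fin (n+1)))} {m : Fin (n+1) → ℕ}
    (hm : suppV m ∉ S) : emon m ∈ SRideal S := by
  have h : charVec (suppV m) ≤ m := (charVec_le_iff _ _).2 subset_rfl
  rw [← tsub_add_cancel_of_le h, ← emon_mul_emon, ← xmon_eq_emon]
  exact Ideal.mul_mem_left _ _ (xmon_mem_SRideal S hm)

lemma coeff_eq_zero_of_mem_SRideal {n : ℕ} {S : Set (Finset (Fin (n+1)))}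
    (hS : IsSimplicialComplex S) {q : MvPolynomial (Fin (n+1)) ℂ} (hq : q ∈ SRideal S)
    {m : Fin (n+1) → ℕ} (hm : suppV m ∈ S) :
    coeff (Finsupp.equivFunOnFinite.symm m) q = 0 := by
  induction hq using Submodule.span_induction generalizing m with
  | mem x hx =>
    obtain ⟨p, hp, rfl⟩ := hx
    have h := coeff_emon_mul (charVec p) m 1
    rwa [mul_one, ← xmon_eq_emon, if_neg] at h
    rw [charVec_le_iff]
    exact fun hpm => hp (hS.2 _ hm _ hpm)
  | zero => simp
  | add x y _ _ hx hy => rw [coeff_add, hx hm, hy hm, add_zero]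
  | smul a x _ hx =>
    rw [smul_eq_mul, coeff_mul]
    refine Finset.sum_eq_zero fun uv huv => ?_
    rw [Finset.HasAntidiagonal.mem_antidiagonal] at huv
    have := hx (m := uv.2) (hS.2 _ hm _ fun i hi => ?_)
    · rw [show Finsupp.equivFunOnFinite.symm (uv.2 : Fin (n+1) → ℕ) = uv.2 by ext; simp] at this
      rw [this, mul_zero]
    · have := DFunLike.congr_fun huv i
      simp only [suppV, Finset.mem_filter, Finset.mem_univ, true_and, Finsupp.add_apply,
        Finsupp.coe_equivFunOnFinite_symm] at this hi ⊢
      omega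

lemma coeff_eq_of_mk_eq_mk_C_mul_emon {n : ℕ} {S : Set (Finset (Fin (n+1)))}
    (hS : IsSimplicialComplex S) {q : MvPolynomial (Fin (n+1)) ℂ} {m : Fin (n+1) → ℕ}
    (hm : suppV m ∈ S) {ν : ℂ}
    (h : Ideal.Quotient.mk (SRideal S) (C ν * emon m) = Ideal.Quotient.mk (SRideal S) q) :
    coeff (Finsupp.equivFunOnFinite.symm m) q = ν := by
  have h0 := coeff_eq_zero_of_mem_SRideal hS (Ideal.Quotient.eq.1 h) hm
  rw [coeff_sub, sub_eq_zero, coeff_C_mul, emon, coeff_monomial, if_pos rfl, mul_one] at h0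
  exact h0.symm

lemma eq_mk_derivation_of_generators {n : ℕ} {S : Set (Finset (Fin (n+1)))}
    {φ : SRideal S →ₗ[MvPolynomial (Fin (n+1)) ℂ] (MvPolynomial (Fin (n+1)) ℂ ⧸ SRideal S)}
    {D : Derivation ℂ (MvPolynomial (Fin (n+1)) ℂ) (MvPolynomial (Fin (n+1)) ℂ)}
    (h : ∀ (p : Finset (Fin (n+1))) (hp : p ∉ S),
      φ ⟨xmon p, xmon_mem_SRideal S hp⟩ = Ideal.Quotient.mk (SRideal S) (D (xmon p)))
    (x : MvPolynomial (Fin (n+1)) ℂ) (hx : x ∈ SRideal S) :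
    φ ⟨x, hx⟩ = Ideal.Quotient.mk (SRideal S) (D x) := by
  induction hx using Submodule.span_induction with
  | mem x hx =>
    obtain ⟨p, hp, rfl⟩ := hx
    exact h p hp
  | zero =>
    rw [map_zero, map_zero]
    exact map_zero φ
  | add x y hx hy ihx ihy =>
    rw [map_add, map_add, ← ihx, ← ihy, ← map_add φ]
    rfl
  | smul a x hx ih =>
    have h1 : φ ⟨a • x, Submodule.smul_mem _ a hx⟩ = a • φ ⟨x, hx⟩ := by
      rw [← map_smul φ]; rfl
    have h2 : Ideal.Quotient.mk (SRideal S) x = 0 := Ideal.Quotient.eq_zero_iff_mem.2 hx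
    rw [h1, ih, smul_eq_mul, Derivation.leibniz, map_add, smul_eq_mul, smul_eq_mul, map_mul,
      map_mul, h2, zero_mul, add_zero]
    rfl

lemma derivation_xmon {n : ℕ}
    (D : Derivation ℂ (MvPolynomial (Fin (n+1)) ℂ) (MvPolynomial (Fin (n+1)) ℂ))
    (p : Finset (Fin (n+1))) :
    D (xmon p) = ∑ i ∈ p, emon (charVec (p.erase i)) * D (X i) := by
  induction p using Finset.induction_on with
  | empty => simp [xmon]
  | insert j p hj ih =>
    have h : xmon (insert j p) = X j * xmon p := Finset.prod_insert hj
    rw [h, Derivation.leibniz, ih, Finset.sum_insert hj, Finset.erase_insert hj,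
      add_comm (X j • _),
      smul_eq_mul, smul_eq_mul, xmon_eq_emon, Finset.mul_sum]
    congr 1
    refine Finset.sum_congr rfl fun i hi => ?_
    have hji : j ≠ i := fun h => hj (h ▸ hi)
    rw [← xmon_eq_emon, ← xmon_eq_emon, Finset.erase_insert_of_ne hji, xmon, xmon,
      Finset.prod_insert (fun h => hj (Finset.mem_of_mem_erase h)), mul_assoc]

lemma degC_nonneg_iff {n : ℕ} {A : Fin (n+1) → ℕ} {b : Finset (Fin (n+1))}
    (hdisj : ∀ i ∈ b, A i = 0) (p : Finset (Fin (n+1))) :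
    (∀ i, 0 ≤ (charVec p i : ℤ) + degC A b i) ↔ b ⊆ p := by
  refine forall_congr' fun i => ?_
  by_cases hi : i ∈ b
  · by_cases hp : i ∈ p <;> simp [charVec, degC, hi, hp, hdisj i hi]
  · simp only [charVec, degC, hi]
    simp only [if_false, false_imp_iff, iff_true]
    split_ifs <;> omega

lemma shiftExp_degC {n : ℕ} {A : Fin (n+1) → ℕ} {b : Finset (Fin (n+1))}
    {p : Finset (Fin (n+1))} (hp : b ⊆ p) :
    shiftExp p (degC A b) = charVec (p \ b) + A := by
  funext i
  have := @hp i
  by_cases hi : i ∈ b <;> by_cases hip : i ∈ p <;> simp_all [shiftExp, charVec, degC]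
  omega

lemma not_charVec_erase_le {n : ℕ} {A : Fin (n+1) → ℕ} {b : Finset (Fin (n+1))}
    (hdisj : ∀ i ∈ b, A i = 0) {p : Finset (Fin (n+1))} (hp : b ⊆ p) {i k : Fin (n+1)}
    (hk : k ∈ b) (hki : k ≠ i) : ¬ charVec (p.erase i) ≤ charVec (p \ b) + A := by
  intro h
  have := h k
  simp [charVec, hk, hki, hp hk, hdisj k hk] at this

lemma suppV_charVec_add {n : ℕ} (A : Fin (n+1) → ℕ) (p : Finset (Fin (n+1))) :
    suppV (charVec p + A) = p ∪ suppV A := by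
  ext i
  by_cases h : i ∈ p <;> simp [suppV, charVec, h]

/-- A homomorphism of degree `𝐚 − 𝐛` induced by a derivation vanishes when `#b ≥ 2`. -/
lemma eq_zero_of_two_le_card {n : ℕ} {S : Set (Finset (Fin (n+1)))}
    (hS : IsSimplicialComplex S) {A : Fin (n+1) → ℕ} {b : Finset (Fin (n+1))}
    (hdisj : ∀ i ∈ b, A i = 0)
    {φ : SRideal S →ₗ[MvPolynomial (Fin (n+1)) ℂ] (MvPolynomial (Fin (n+1)) ℂ ⧸ SRideal S)}
    (hφ : IsHomOfDeg S φ (degC A b)) (hcard : 2 ≤ b.card)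
    (D : Derivation ℂ (MvPolynomial (Fin (n+1)) ℂ) (MvPolynomial (Fin (n+1)) ℂ))
    (hD : ∀ (x : MvPolynomial (Fin (n+1)) ℂ) (hx : x ∈ SRideal S),
      φ ⟨x, hx⟩ = Ideal.Quotient.mk (SRideal S) (D x)) : φ = 0 := by
  suffices h : ∀ (p : Finset (Fin (n+1))) (hp : p ∉ S),
      φ ⟨xmon p, xmon_mem_SRideal S hp⟩ = 0 by
    ext ⟨x, hx⟩
    simpa using eq_mk_derivation_of_generators (φ := φ) (D := 0) (fun p hp => by simpa using h p hp)
      x hx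
  intro p hp
  by_cases hbp : b ⊆ p
  · obtain ⟨ν, hν⟩ := (hφ p hp).1 ((degC_nonneg_iff hdisj p).2 hbp)
    rw [shiftExp_degC hbp] at hν
    by_cases hm : suppV (charVec (p \ b) + A) ∈ S
    · have h0 := coeff_eq_of_mk_eq_mk_C_mul_emon hS hm (hν.symm.trans (hD _ _))
      rw [derivation_xmon, coeff_sum, Finset.sum_eq_zero] at h0
      · rw [hν, ← h0]
        simp
      · intro i _
        obtain ⟨k, hk, hki⟩ := Finset.exists_mem_ne hcard i
        rw [coeff_emon_mul, if_neg (not_charVec_erase_le hdisj hbp hk hki)]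
    · rw [hν, Ideal.Quotient.eq_zero_iff_mem]
      exact Ideal.mul_mem_left _ _ (emon_mem_SRideal hm)
  · exact (hφ p hp).2 (mt (degC_nonneg_iff hdisj p).1 hbp)

/-- A homomorphism of degree `𝐚 − e_j` induced by a derivation `D` has constant `λ_φ`, equal to the
coefficient of `x^𝐚` in `D x_j`. -/
lemma apply_xmon_union_singleton {n : ℕ} {S : Set (Finset (Fin (n+1)))}
    (hS : IsSimplicialComplex S) {A : Fin (n+1) → ℕ} {j : Fin (n+1)} (hj : A j = 0)
    {φ : SRideal S →ₗ[MvPolynomial (Fin (n+1)) ℂ] (MvPolynomial (Fin (n+1)) ℂ ⧸ SRideal S)}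
    (hφ : IsHomOfDeg S φ (degC A {j}))
    (D : Derivation ℂ (MvPolynomial (Fin (n+1)) ℂ) (MvPolynomial (Fin (n+1)) ℂ))
    (hD : ∀ (x : MvPolynomial (Fin (n+1)) ℂ) (hx : x ∈ SRideal S),
      φ ⟨x, hx⟩ = Ideal.Quotient.mk (SRideal S) (D x))
    (f : Finset (Fin (n+1))) (hf : f ∈ Nab S (suppV A) {j}) :
    φ ⟨xmon (f ∪ {j}), xmon_mem_SRideal S hf.2.2.2⟩ = Ideal.Quotient.mk (SRideal S)
      (C (coeff (Finsupp.equivFunOnFinite.symm A) (D (X j))) *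
        emon (fun i => charVec f i + A i)) := by
  have hdisj : ∀ i ∈ ({j} : Finset (Fin (n+1))), A i = 0 := by simpa using hj
  have hsub : ({j} : Finset (Fin (n+1))) ⊆ f ∪ {j} := Finset.subset_union_right
  have hjf : j ∉ f := by
    rw [← Finset.disjoint_singleton_right, Finset.disjoint_iff_inter_eq_empty]
    exact hf.2.2.1
  have hsdiff : (f ∪ {j}) \ {j} = f := by
    rw [Finset.union_sdiff_right, Finset.sdiff_singleton_eq_erase, Finset.erase_eq_of_notMem hjf]
  have hm : suppV (charVec f + A) ∈ S := by
    rw [suppV_charVec_add, Finset.union_eq_left.2 hf.2.1]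
    exact hf.1
  obtain ⟨ν, hν⟩ := (hφ _ hf.2.2.2).1 ((degC_nonneg_iff hdisj _).2 hsub)
  rw [shiftExp_degC hsub, hsdiff] at hν
  have h0 := coeff_eq_of_mk_eq_mk_C_mul_emon hS hm (hν.symm.trans (hD _ _))
  rw [derivation_xmon, coeff_sum, Finset.sum_eq_single_of_mem j (hsub (by simp))] at h0
  · have he : (f ∪ {j}).erase j = f := by rw [Finset.erase_eq, hsdiff]
    rw [coeff_emon_mul, he, if_pos le_self_add, add_tsub_cancel_left] at h0
    rw [hν, h0]
    rfl
  · intro i _ hij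
    have := not_charVec_erase_le hdisj hsub (Finset.mem_singleton_self j) hij.symm
    rw [hsdiff] at this
    rw [coeff_emon_mul, if_neg this]

/-- If `λ_φ` is constant, equal to `μ`, then `φ` of degree `𝐚 − e_j` is induced by the derivation
`μ x^𝐚 ∂/∂x_j`. -/
lemma exists_derivation_of_constant {n : ℕ} {S : Set (Finset (Fin (n+1)))}
    (hS : IsSimplicialComplex S) {A : Fin (n+1) → ℕ} {j : Fin (n+1)} (hj : A j = 0)
    {φ : SRideal S →ₗ[MvPolynomial (Fin (n+1)) ℂ] (MvPolynomial (Fin (n+1)) ℂ ⧸ SRideal S)}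
    (hφ : IsHomOfDeg S φ (degC A {j})) {μ : ℂ}
    (hμ : ∀ (f : Finset (Fin (n+1))) (hf : f ∈ Nab S (suppV A) {j}),
      φ ⟨xmon (f ∪ {j}), xmon_mem_SRideal S hf.2.2.2⟩ =
        Ideal.Quotient.mk (SRideal S) (C μ * emon (fun i => charVec f i + A i))) :
    ∃ D : Derivation ℂ (MvPolynomial (Fin (n+1)) ℂ) (MvPolynomial (Fin (n+1)) ℂ),
      ∀ (x : MvPolynomial (Fin (n+1)) ℂ) (hx : x ∈ SRideal S),
        φ ⟨x, hx⟩ = Ideal.Quotient.mk (SRideal S) (D x) := by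
  have hdisj : ∀ i ∈ ({j} : Finset (Fin (n+1))), A i = 0 := by simpa using hj
  refine ⟨(C μ * emon A) • pderiv j, eq_mk_derivation_of_generators fun p hp => ?_⟩
  have hX : ∀ i, i ≠ j → ((C μ * emon A) • pderiv j : Derivation ℂ _ _)
      (X i : MvPolynomial (Fin (n+1)) ℂ) = 0 := fun i hi => by
    rw [Derivation.smul_apply, pderiv_X_of_ne hi, smul_zero]
  by_cases hjp : j ∈ p
  · have hsub : ({j} : Finset (Fin (n+1))) ⊆ p := Finset.singleton_subset_iff.2 hjp
    have hval : ((C μ * emon A) • pderiv j : Derivation ℂ _ _) (xmon p) =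
        C μ * emon (charVec (p \ {j}) + A) := by
      rw [derivation_xmon, Finset.sum_eq_single_of_mem j hjp
        (fun i _ hi => by rw [hX i hi, mul_zero]), Derivation.smul_apply, pderiv_X_self,
        smul_eq_mul, mul_one, Finset.erase_eq, ← emon_mul_emon]
      ring
    obtain ⟨ν, hν⟩ := (hφ p hp).1 ((degC_nonneg_iff hdisj p).2 hsub)
    rw [shiftExp_degC hsub] at hν
    rw [hval, hν]
    by_cases hm : suppV (charVec (p \ {j}) + A) ∈ S
    · have hjA : j ∉ suppV A := by simp [suppV, hj]
      set f := p \ {j} ∪ suppV A with hf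
      have hjf : j ∉ f := by simp [hf, hjA]
      have hpf : p ⊆ f ∪ {j} := fun i hi => by
        by_cases h : i = j <;> simp [hf, h, hi]
      have hfS : f ∈ S := by rwa [suppV_charVec_add] at hm
      have hfN : f ∈ Nab S (suppV A) {j} :=
        ⟨hfS, Finset.subset_union_right, by
          rwa [← Finset.disjoint_iff_inter_eq_empty, Finset.disjoint_singleton_right],
          fun h => hp (hS.2 _ h _ hpf)⟩
      have hsplit : xmon (f ∪ {j}) = xmon ((f ∪ {j}) \ p) * xmon p :=
        (Finset.prod_sdiff hpf).symm
      have hexp : charVec ((f ∪ {j}) \ p) + (charVec (p \ {j}) + A) = charVec f + A := by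
        rw [← add_assoc]
        congr 1
        funext i
        by_cases h : i = j
        · subst h
          simp [charVec, hjp, hjf]
        · have := @hpf i
          by_cases h1 : i ∈ p <;> by_cases h2 : i ∈ f <;> simp_all [charVec]
      have hmul : φ ⟨xmon (f ∪ {j}), xmon_mem_SRideal S hfN.2.2.2⟩ =
          Ideal.Quotient.mk (SRideal S) (C ν * emon (charVec f + A)) := by
        have h1 : φ ⟨xmon (f ∪ {j}), xmon_mem_SRideal S hfN.2.2.2⟩ =
            xmon ((f ∪ {j}) \ p) • φ ⟨xmon p, xmon_mem_SRideal S hp⟩ := by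
          rw [← map_smul φ]
          congr 1
          exact Subtype.ext hsplit
        have h2 : xmon ((f ∪ {j}) \ p) * (C ν * emon (charVec (p \ {j}) + A)) =
            C ν * emon (charVec f + A) := by
          rw [← hexp, ← emon_mul_emon (charVec ((f ∪ {j}) \ p)), xmon_eq_emon]
          ring
        rw [h1, hν, ← h2]
        rfl
      have hfm : suppV (charVec f + A) ∈ S := by
        rwa [suppV_charVec_add, Finset.union_eq_left.2 hfN.2.1]
      have hc := coeff_eq_of_mk_eq_mk_C_mul_emon hS hfm (hmul.symm.trans (hμ f hfN))
      have hμc : coeff (Finsupp.equivFunOnFinite.symm (charVec f + A))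
          (C μ * emon (fun i => charVec f i + A i)) = μ :=
        coeff_eq_of_mk_eq_mk_C_mul_emon hS hfm rfl
      rw [← hc, hμc]
    · rw [Ideal.Quotient.eq.2]
      exact Ideal.sub_mem _ (Ideal.mul_mem_left _ _ (emon_mem_SRideal hm))
        (Ideal.mul_mem_left _ _ (emon_mem_SRideal hm))
  · rw [(hφ p hp).2 (by rwa [degC_nonneg_iff hdisj, Finset.singleton_subset_iff]),
      derivation_xmon, Finset.sum_eq_zero, map_zero]
    intro i hi
    rw [hX i (fun h => hjp (h ▸ hi)), mul_zero]

/-- `φ ∈ Hom(I_X, A_X)_𝐜` lies in the image of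
`Der_ℂ(P,P) → Hom_P(I_X,A_X)`, `D ↦ π ∘ D|_{I_X}`, iff `φ = 0`, or `#b = 1` and the
function `λ_φ : N_{a−b} → ℂ` is constant.  In particular for `#b ≥ 2` only the zero
homomorphism comes from a derivation. -/
theorem trivial_deformations {n : ℕ} (S : Set (Finset (Fin (n+1))))
    (hS : IsSimplicialComplex S) (A : Fin (n+1) → ℕ) (b : Finset (Fin (n+1)))
    (hb : b ≠ ∅) (hdisj : ∀ i ∈ b, A i = 0)
    (φ : SRideal S →ₗ[MvPolynomial (Fin (n+1)) ℂ]
          (MvPolynomial (Fin (n+1)) ℂ ⧸ SRideal S))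
    (hφ : IsHomOfDeg S φ (degC A b)) :
    ((∃ D : Derivation ℂ (MvPolynomial (Fin (n+1)) ℂ) (MvPolynomial (Fin (n+1)) ℂ),
        ∀ (x : MvPolynomial (Fin (n+1)) ℂ) (hx : x ∈ SRideal S),
          φ ⟨x, hx⟩ = Ideal.Quotient.mk (SRideal S) (D x)) ↔
      (φ = 0 ∨ (b.card = 1 ∧ ∃ μ : ℂ, ∀ (f : Finset (Fin (n+1)))
        (hf : f ∈ Nab S (suppV A) b),
        φ ⟨xmon (f ∪ b), xmon_mem_SRideal S hf.2.2.2⟩ =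
          Ideal.Quotient.mk (SRideal S)
            (C μ * emon (fun i => charVec f i + A i))))) ∧
    (2 ≤ b.card →
      (∃ D : Derivation ℂ (MvPolynomial (Fin (n+1)) ℂ) (MvPolynomial (Fin (n+1)) ℂ),
        ∀ (x : MvPolynomial (Fin (n+1)) ℂ) (hx : x ∈ SRideal S),
          φ ⟨x, hx⟩ = Ideal.Quotient.mk (SRideal S) (D x)) → φ = 0) := by
  refine ⟨⟨?_, ?_⟩, fun hcard ⟨D, hD⟩ => eq_zero_of_two_le_card hS hdisj hφ hcard D hD⟩
  · rintro ⟨D, hD⟩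
    have hpos : 0 < b.card := Finset.card_pos.2 (Finset.nonempty_iff_ne_empty.2 hb)
    rcases (by omega : b.card = 1 ∨ 2 ≤ b.card) with h1 | h2
    · obtain ⟨j, rfl⟩ := Finset.card_eq_one.1 h1
      exact Or.inr ⟨h1, _, apply_xmon_union_singleton hS (hdisj j (by simp)) hφ D hD⟩
    · exact Or.inl (eq_zero_of_two_le_card hS hdisj hφ h2 D hD)
  · rintro (rfl | ⟨h1, μ, hμ⟩)
    · exact ⟨0, fun x hx => by simp⟩
    · obtain ⟨j, rfl⟩ := Finset.card_eq_one.1 h1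
      exact exists_derivation_of_constant hS (hdisj j (by simp)) hφ hμ
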